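/- arXiv:1308.0066 — 2 statements merged into one kernel-verified Lean document; each statement's English description precedes it below -/
import Mathlib

section
/- For every integer s ≥ 1, the sum of the first s terms of the sequence ξ satisfies the upper bound ∑_{i=1}^{s} ξ_i ≤ s·log₂(s) + s. -/
/-- The sequence ξ_i = i XOR (i-1), for positive integers i. -/
def xi (i : ℕ) : ℕ := i ^^^ (i - 1)

theorem xi_two_mul_add_one (m : ℕ) : xi (2 * m + 1) = 1 := by
  simpa [xi, Nat.bit_val] using Nat.xor_bit true m false m

theorem xi_two_mul_add_two (m : ℕ) : xi (2 * m + 2) = 2 * xi (m + 1) + 1 := by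
  simpa [xi, Nat.bit_val, mul_add] using Nat.xor_bit false (m + 1) true m

theorem sum_xi_two_mul (m : ℕ) :
    ∑ i ∈ Finset.Icc 1 (2 * m), xi i = 2 * ∑ i ∈ Finset.Icc 1 m, xi i + 2 * m := by
  induction m with
  | zero => simp
  | succ m ih =>
    rw [show 2 * (m + 1) = 2 * m + 1 + 1 by ring, Finset.sum_Icc_succ_top (by omega),
      Finset.sum_Icc_succ_top (by omega), Finset.sum_Icc_succ_top (by omega), ih,
      xi_two_mul_add_one, xi_two_mul_add_two]
    ring

theorem sum_xi_two_mul_add_one (m : ℕ) :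
    ∑ i ∈ Finset.Icc 1 (2 * m + 1), xi i = 2 * ∑ i ∈ Finset.Icc 1 m, xi i + 2 * m + 1 := by
  rw [Finset.sum_Icc_succ_top (by omega), sum_xi_two_mul, xi_two_mul_add_one]

/-- For every integer `s ≥ 1`, the sum of the first `s` terms of the sequence `ξ`
satisfies `∑_{i=1}^{s} ξ_i ≤ s·log₂ s + s`. -/
theorem xi_sum_upper_bound (s : ℕ) (hs : 1 ≤ s) :
    ((∑ i ∈ Finset.Icc 1 s, xi i : ℕ) : ℝ) ≤ s * Real.logb 2 s + s := by
  induction s using Nat.strong_induction_on with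
  | _ s ih =>
    have logb_two_mul {m : ℕ} (hm : 1 ≤ m) :
        Real.logb 2 (2 * m : ℝ) = 1 + Real.logb 2 m := by
      rw [Real.logb_mul two_ne_zero (by positivity), Real.logb_self_eq_one one_lt_two]
    obtain ⟨m, rfl | rfl⟩ := Nat.even_or_odd' s
    · have hm : 1 ≤ m := by omega
      have h := ih m (by omega) hm
      rw [sum_xi_two_mul]
      push_cast at h ⊢
      rw [logb_two_mul hm]
      linarith
    · rw [sum_xi_two_mul_add_one]
      rcases Nat.eq_zero_or_pos m with rfl | hm
      · simp
      have h := ih m (by omega) hm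
      have hm' : (1 : ℝ) ≤ m := by exact_mod_cast hm
      have hmono : Real.logb 2 (2 * m : ℝ) ≤ Real.logb 2 (2 * m + 1) :=
        Real.logb_le_logb_of_le one_lt_two (by positivity) (by linarith)
      have hnonneg : 0 ≤ Real.logb 2 (2 * m + 1 : ℝ) :=
        Real.logb_nonneg one_lt_two (by linarith)
      rw [logb_two_mul hm] at hmono
      have hmul := mul_le_mul_of_nonneg_left hmono (by positivity : (0 : ℝ) ≤ 2 * m)
      push_cast at h ⊢
      linarith
end

section
/- Let α_1, α_2, …, α_k be a finite sequence of positive integers with sum s. Then there exists a strictly increasing function f from {1, …, k} to {1, …, s} such that α_i ≤ ξ_{f(i)} for all i with 1 ≤ i ≤ k; that is, the sequence α is termwise dominated by a subsequence of the first s terms of ξ. -/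
theorem xi_pos {n : ℕ} (hn : 0 < n) : 0 < xi n := by
  have h : xi n ≠ 0 := by
    rw [xi, Ne, Nat.xor_eq_zero_iff]
    omega
  omega

theorem xi_two_mul {n : ℕ} (hn : 0 < n) : xi (2 * n) = 2 * xi n + 1 := by
  have h := Nat.xor_bit false n true (n - 1)
  simp only [Nat.bit_val] at h
  have e : 2 * n - 1 = 2 * (n - 1) + 1 := by omega
  rw [xi, xi, e]
  simpa using h

theorem two_pow_succ_le_xi_add_one (k : ℕ) {n : ℕ} (hn : 0 < n) :
    2 ^ (k + 1) ≤ xi (2 ^ k * n) + 1 := by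
  induction k with
  | zero =>
    have := xi_pos hn
    simp
    omega
  | succ k ih =>
    rw [pow_succ' 2 k, mul_assoc, xi_two_mul (by positivity), pow_succ' 2 (k + 1)]
    omega

/-- Every interval `(a, a + b]` of natural numbers with `b > 0` contains an index at which
`xi` is at least `b`. -/
theorem exists_le_xi_of_interval (a : ℕ) {b : ℕ} (hb : 0 < b) :
    ∃ n, a < n ∧ n ≤ a + b ∧ b ≤ xi n := by
  have hle : 2 ^ Nat.log 2 b ≤ b := Nat.pow_log_le_self 2 hb.ne'
  have hlt : b < 2 ^ (Nat.log 2 b + 1) := Nat.lt_pow_succ_log_self one_lt_two b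
  have hdiv := Nat.div_add_mod (a + b) (2 ^ Nat.log 2 b)
  have hmod := Nat.mod_lt (a + b) (show 0 < 2 ^ Nat.log 2 b by positivity)
  have hq : 0 < (a + b) / 2 ^ Nat.log 2 b := Nat.div_pos (by omega) (by positivity)
  have hxi := two_pow_succ_le_xi_add_one (Nat.log 2 b) hq
  exact ⟨2 ^ Nat.log 2 b * ((a + b) / 2 ^ Nat.log 2 b), by omega, by omega, by omega⟩

/-- Any finite sequence of positive integers `α_1, …, α_k` with sum `s` is termwise
dominated by a subsequence of the first `s` terms of `ξ`: there is a strictly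
increasing `f : {1,…,k} → {1,…,s}` with `α_i ≤ ξ_{f(i)}` for all `i`. -/
theorem xi_dominates_subsequence (k s : ℕ) (α : Fin k → ℕ)
    (hpos : ∀ i, 0 < α i) (hsum : ∑ i, α i = s) :
    ∃ f : Fin k → ℕ, StrictMono f ∧ (∀ i, 1 ≤ f i ∧ f i ≤ s) ∧
      ∀ i, α i ≤ xi (f i) := by
  choose f hlow hup hxi using
    fun i => exists_le_xi_of_interval (∑ j ∈ Finset.Iio i, α j) (hpos i)
  have hIic (i : Fin k) : ∑ j ∈ Finset.Iio i, α j + α i = ∑ j ∈ Finset.Iic i, α j := by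
    rw [← Finset.Iio_insert, Finset.sum_insert (by simp), add_comm]
  refine ⟨f, fun i j hij => ?_, fun i => ⟨by have := hlow i; omega, ?_⟩, hxi⟩
  · have hsub : Finset.Iic i ⊆ Finset.Iio j := fun x hx => by
      simp only [Finset.mem_Iic, Finset.mem_Iio] at hx ⊢
      exact hx.trans_lt hij
    calc f i ≤ ∑ x ∈ Finset.Iic i, α x := (hup i).trans_eq (hIic i)
      _ ≤ ∑ x ∈ Finset.Iio j, α x := Finset.sum_le_sum_of_subset hsub
      _ < f j := hlow j
  · calc f i ≤ ∑ x ∈ Finset.Iic i, α x := (hup i).trans_eq (hIic i)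
      _ ≤ ∑ x, α x := Finset.sum_le_sum_of_subset (Finset.subset_univ _)
      _ = s := hsum
end
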